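/- Let n ≥ 1 and let A be an invertible n×n real matrix whose singular values satisfy σ₁ > σ₂ > … > σₙ > 0. Then the minimizer of the Frobenius norm ‖X − A‖_F over X ∈ SO(n) is unique; i.e., if X₁, X₂ ∈ SO(n) both satisfy ‖Xᵢ − A‖_F ≤ ‖X − A‖_F for all X ∈ SO(n), then X₁ = X₂. -/

import Mathlib

open Matrix BigOperators

/-- Frobenius norm of a real square matrix. -/
noncomputable def frobNorm {n : ℕ} (M : Matrix (Fin n) (Fin n) ℝ) : ℝ :=
  Real.sqrt (∑ i, ∑ j, (M i j) ^ 2)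

/-- Membership in the orthogonal group `O(n)`. -/
def IsOrth {n : ℕ} (X : Matrix (Fin n) (Fin n) ℝ) : Prop :=
  Xᵀ * X = 1 ∧ X * Xᵀ = 1

/-- Membership in the special orthogonal group `SO(n)`. -/
def IsSO {n : ℕ} (X : Matrix (Fin n) (Fin n) ℝ) : Prop :=
  Xᵀ * X = 1 ∧ X * Xᵀ = 1 ∧ X.det = 1


theorem orth_row {n : ℕ} {Y : Matrix (Fin n) (Fin n) ℝ} (hY : Y * Yᵀ = 1) (i : Fin n) :
    ∑ j, (Y i j) ^ 2 = 1 := by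
  have h := congrFun (congrFun hY i) i
  simp only [Matrix.mul_apply, Matrix.transpose_apply, Matrix.one_apply_eq] at h
  rw [← h]
  exact Finset.sum_congr rfl fun j _ => by ring

theorem orth_diag_le {n : ℕ} {Y : Matrix (Fin n) (Fin n) ℝ} (hY : Y * Yᵀ = 1) (i : Fin n) :
    Y i i ≤ 1 := by
  have h := orth_row hY i
  have h2 : (Y i i) ^ 2 ≤ ∑ j, (Y i j) ^ 2 :=
    Finset.single_le_sum (f := fun j => (Y i j) ^ 2) (fun j _ => sq_nonneg _) (Finset.mem_univ i)
  nlinarith [sq_nonneg (Y i i - 1)]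

theorem orth_eq_diag {n : ℕ} {Y : Matrix (Fin n) (Fin n) ℝ} (hY : Y * Yᵀ = 1) (e : Fin n → ℝ)
    (he : ∀ i, (e i) ^ 2 = 1) (hd : ∀ i, Y i i = e i) : Y = Matrix.diagonal e := by
  ext i j
  by_cases hij : i = j
  · subst hij; simp [hd]
  · rw [Matrix.diagonal_apply_ne _ hij]
    have h := orth_row hY i
    rw [← Finset.add_sum_erase _ _ (Finset.mem_univ i), hd, he] at h
    have h0 : ∑ k ∈ Finset.univ.erase i, (Y i k) ^ 2 = 0 := by linarith
    rw [Finset.sum_eq_zero_iff_of_nonneg (fun k _ => sq_nonneg _)] at h0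
    exact pow_eq_zero_iff (two_ne_zero) |>.1
      (h0 j (Finset.mem_erase.2 ⟨fun h => hij h.symm, Finset.mem_univ _⟩))

theorem orth_trace_le {n : ℕ} {Y : Matrix (Fin n) (Fin n) ℝ} (hY : Y * Yᵀ = 1) :
    Y.trace ≤ n := by
  have : Y.trace ≤ ∑ _i : Fin n, (1 : ℝ) := Finset.sum_le_sum fun i _ => orth_diag_le hY i
  simpa using this

theorem orth_trace_le_of_neg {n : ℕ} {Y : Matrix (Fin n) (Fin n) ℝ} (hY : Y * Yᵀ = 1)
    (hdet : Y.det = -1) : Y.trace ≤ n - 2 := by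
  have h1 : (Y + 1).det = 0 := by
    have e : Y + 1 = Y * (1 + Y)ᵀ := by
      rw [Matrix.transpose_add, Matrix.mul_add, hY, Matrix.transpose_one, Matrix.mul_one]
    have h := congrArg Matrix.det e
    rw [Matrix.det_mul, Matrix.det_transpose, hdet, add_comm 1 Y] at h
    linarith
  obtain ⟨v, hv, hv0⟩ := Matrix.exists_mulVec_eq_zero_iff.2 h1
  have hYv : Y *ᵥ v = -v := by
    rw [Matrix.add_mulVec, Matrix.one_mulVec] at hv0
    exact eq_neg_of_add_eq_zero_left hv0
  have hs : v ⬝ᵥ v ≠ 0 := fun h => hv (dotProduct_self_eq_zero.1 h)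
  set s := v ⬝ᵥ v with hsdef
  set H : Matrix (Fin n) (Fin n) ℝ := 1 - (2 / s) • Matrix.vecMulVec v v with hH
  have hHT : Hᵀ = H := by
    simp [hH, Matrix.transpose_vecMulVec]
  have hHH : H * H = 1 := by
    have e : Matrix.vecMulVec v v * Matrix.vecMulVec v v = s • Matrix.vecMulVec v v := by
      ext i j
      simp only [Matrix.mul_apply, Matrix.vecMulVec_apply, Matrix.smul_apply, smul_eq_mul, hsdef,
        dotProduct, Finset.sum_mul]
      exact Finset.sum_congr rfl fun k _ => by ring
    rw [hH, Matrix.sub_mul, Matrix.one_mul, Matrix.mul_sub, Matrix.mul_one,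
      Matrix.smul_mul, Matrix.mul_smul, e, smul_smul, smul_smul]
    have : 2 / s * (2 / s) * s = 2 / s + 2 / s := by field_simp; norm_num
    rw [this, add_smul]
    abel
  have ho : (Y * H) * (Y * H)ᵀ = 1 := by
    rw [Matrix.transpose_mul, hHT, Matrix.mul_assoc, ← Matrix.mul_assoc H, hHH, Matrix.one_mul, hY]
  have ht := orth_trace_le ho
  have htr : (Y * H).trace = Y.trace + 2 := by
    rw [hH, Matrix.mul_sub, Matrix.mul_one, Matrix.mul_smul, Matrix.mul_vecMulVec, hYv,
      Matrix.trace_sub, Matrix.trace_smul, Matrix.trace_vecMulVec, neg_dotProduct, ← hsdef,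
      smul_eq_mul]
    field_simp
    ring
  linarith

theorem key_pos {n : ℕ} {Y : Matrix (Fin n) (Fin n) ℝ} (hY : Y * Yᵀ = 1)
    (σ : Fin n → ℝ) (hσ : ∀ i, 0 < σ i) (h : ∑ i, σ i ≤ ∑ i, Y i i * σ i) :
    Y = Matrix.diagonal (fun _ => 1) := by
  apply orth_eq_diag hY _ (fun i => by norm_num)
  have hnn : ∀ i ∈ Finset.univ, 0 ≤ σ i - Y i i * σ i := fun i _ => by
    nlinarith [orth_diag_le hY i, hσ i]
  have h0 : ∑ i, (σ i - Y i i * σ i) = 0 :=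
    le_antisymm (by rw [Finset.sum_sub_distrib]; linarith) (Finset.sum_nonneg hnn)
  rw [Finset.sum_eq_zero_iff_of_nonneg hnn] at h0
  intro i
  have := h0 i (Finset.mem_univ i)
  have h3 : (1 - Y i i) * σ i = 0 := by linarith
  rcases mul_eq_zero.1 h3 with h | h
  · linarith
  · exact absurd h (ne_of_gt (hσ i))

/-- The signs `(1, …, 1, -1)`. -/
def lastNeg (m : ℕ) (i : Fin (m + 1)) : ℝ := if i = Fin.last m then -1 else 1

theorem key_neg {m : ℕ} {Y : Matrix (Fin (m + 1)) (Fin (m + 1)) ℝ} (hY : Y * Yᵀ = 1)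
    (hdet : Y.det = -1) (σ : Fin (m + 1) → ℝ) (hσ : ∀ i, 0 < σ i) (hanti : StrictAnti σ)
    (h : ∑ i, lastNeg m i * σ i ≤ ∑ i, Y i i * σ i) :
    Y = Matrix.diagonal (lastNeg m) := by
  have htr := orth_trace_le_of_neg hY hdet
  have htrc : ∑ i : Fin m, Y i.castSucc i.castSucc + Y (Fin.last m) (Fin.last m) ≤ m - 1 := by
    rw [Matrix.trace, Fin.sum_univ_castSucc] at htr
    push_cast at htr
    simp only [Matrix.diag_apply] at htr
    linarith
  have hne : ∀ i : Fin m, i.castSucc ≠ Fin.last m := fun i => (Fin.castSucc_lt_last i).ne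
  rw [Fin.sum_univ_castSucc, Fin.sum_univ_castSucc] at h
  simp only [lastNeg, hne, if_false, if_true, one_mul] at h
  set s := σ (Fin.last m) with hs
  have hlt : ∀ i : Fin m, s < σ i.castSucc := fun i => hanti (Fin.castSucc_lt_last i)
  have hnn : ∀ i ∈ (Finset.univ : Finset (Fin m)),
      0 ≤ (1 - Y i.castSucc i.castSucc) * (σ i.castSucc - s) := fun i _ =>
    mul_nonneg (by linarith [orth_diag_le hY i.castSucc]) (by linarith [hlt i])
  have hexp : ∑ i : Fin m, (1 - Y i.castSucc i.castSucc) * (σ i.castSucc - s)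
      = ∑ i : Fin m, σ i.castSucc - ∑ i : Fin m, Y i.castSucc i.castSucc * σ i.castSucc
        - m * s + (∑ i : Fin m, Y i.castSucc i.castSucc) * s := by
    have : (m : ℝ) * s = ∑ _i : Fin m, s := by simp
    rw [this, Finset.sum_mul, ← Finset.sum_sub_distrib, ← Finset.sum_sub_distrib,
      ← Finset.sum_add_distrib]
    exact Finset.sum_congr rfl fun i _ => by ring
  have hspos : 0 < s := hσ _
  have h0 : ∑ i : Fin m, (1 - Y i.castSucc i.castSucc) * (σ i.castSucc - s) = 0 := by
    refine le_antisymm ?_ (Finset.sum_nonneg hnn)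
    rw [hexp]
    nlinarith
  rw [Finset.sum_eq_zero_iff_of_nonneg hnn] at h0
  have h1 : ∀ i : Fin m, Y i.castSucc i.castSucc = 1 := fun i => by
    rcases mul_eq_zero.1 (h0 i (Finset.mem_univ i)) with h | h
    · linarith
    · linarith [hlt i]
  have h2 : Y (Fin.last m) (Fin.last m) = -1 := by
    simp only [h1, one_mul] at h htrc
    simp at htrc
    have : -1 ≤ Y (Fin.last m) (Fin.last m) := by
      by_contra hc
      push Not at hc
      nlinarith
    linarith
  apply orth_eq_diag hY
  · intro i; unfold lastNeg; split_ifs <;> norm_num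
  · intro i
    induction i using Fin.lastCases with
    | last => simp [lastNeg, h2]
    | cast i => simp [lastNeg, hne, h1]

theorem frob_sq {n : ℕ} (M : Matrix (Fin n) (Fin n) ℝ) :
    ∑ i, ∑ j, (M i j) ^ 2 = (Mᵀ * M).trace := by
  rw [Finset.sum_comm]
  simp only [Matrix.trace, Matrix.diag_apply, Matrix.mul_apply, Matrix.transpose_apply]
  exact Finset.sum_congr rfl fun i _ => Finset.sum_congr rfl fun j _ => by ring

theorem frob_le {n : ℕ} {A X Z : Matrix (Fin n) (Fin n) ℝ} (hX : Xᵀ * X = 1) (hZ : Zᵀ * Z = 1)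
    (h : frobNorm (X - A) ≤ frobNorm (Z - A)) : (Zᵀ * A).trace ≤ (Xᵀ * A).trace := by
  have key : ∀ W : Matrix (Fin n) (Fin n) ℝ, Wᵀ * W = 1 →
      ∑ i, ∑ j, ((W - A) i j) ^ 2 = n - 2 * (Wᵀ * A).trace + (Aᵀ * A).trace := by
    intro W hW
    have e : (Aᵀ * W).trace = (Wᵀ * A).trace := by
      rw [← Matrix.trace_transpose, Matrix.transpose_mul, Matrix.transpose_transpose]
    rw [frob_sq, Matrix.transpose_sub, Matrix.sub_mul, Matrix.mul_sub, Matrix.mul_sub, hW,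
      Matrix.trace_sub, Matrix.trace_sub, Matrix.trace_sub, e, Matrix.trace_one, Fintype.card_fin]
    ring
  unfold frobNorm at h
  have hle := (Real.sqrt_le_sqrt_iff
    (Finset.sum_nonneg fun i _ => Finset.sum_nonneg fun j _ => sq_nonneg ((Z - A) i j))).1 h
  rw [key X hX, key Z hZ] at hle
  linarith

theorem trace_conv {n : ℕ} (U V X : Matrix (Fin n) (Fin n) ℝ) (σ : Fin n → ℝ) :
    (Xᵀ * (U * Matrix.diagonal σ * Vᵀ)).trace = ∑ i, (Uᵀ * X * V) i i * σ i := by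
  have : (Xᵀ * (U * Matrix.diagonal σ * Vᵀ)).trace
      = ((Uᵀ * X * V)ᵀ * Matrix.diagonal σ).trace := by
    rw [← Matrix.mul_assoc, Matrix.trace_mul_comm]
    simp only [Matrix.transpose_mul, Matrix.transpose_transpose, Matrix.mul_assoc]
  rw [this]
  simp only [Matrix.trace, Matrix.diag_apply, Matrix.mul_diagonal, Matrix.transpose_apply]

theorem eq_of_diag {n : ℕ} {U V A : Matrix (Fin n) (Fin n) ℝ} {σ : Fin n → ℝ}
    (hU : IsOrth U) (hV : IsOrth V) (hSVD : A = U * Matrix.diagonal σ * Vᵀ)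
    (e : Fin n → ℝ) (he : ∀ i, (e i) ^ 2 = 1)
    (hdet : (Matrix.diagonal e).det = U.det * V.det)
    (huniq : ∀ Y : Matrix (Fin n) (Fin n) ℝ, Y * Yᵀ = 1 → Y.det = U.det * V.det →
      ∑ i, e i * σ i ≤ ∑ i, Y i i * σ i → Y = Matrix.diagonal e)
    (X : Matrix (Fin n) (Fin n) ℝ) (hX : IsSO X)
    (hmin : ∀ Z : Matrix (Fin n) (Fin n) ℝ, IsSO Z → frobNorm (X - A) ≤ frobNorm (Z - A)) :
    X = U * Matrix.diagonal e * Vᵀ := by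
  obtain ⟨hU1, hU2⟩ := hU
  obtain ⟨hV1, hV2⟩ := hV
  have dU : U.det * U.det = 1 := by
    have := congrArg Matrix.det hU1
    rwa [Matrix.det_mul, Matrix.det_transpose, Matrix.det_one] at this
  have dV : V.det * V.det = 1 := by
    have := congrArg Matrix.det hV1
    rwa [Matrix.det_mul, Matrix.det_transpose, Matrix.det_one] at this
  have hDD : Matrix.diagonal e * Matrix.diagonal e = 1 := by
    rw [Matrix.diagonal_mul_diagonal, ← Matrix.diagonal_one]
    congr 1; funext i; rw [← he i]; ring
  set D := Matrix.diagonal e with hD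
  have hDT : Dᵀ = D := Matrix.diagonal_transpose e
  have c1 : ∀ M N P Q : Matrix (Fin n) (Fin n) ℝ, N * P = 1 → M * N * (P * Q) = M * Q := by
    intro M N P Q h
    rw [Matrix.mul_assoc, ← Matrix.mul_assoc N, h, Matrix.one_mul]
  set Z := U * D * Vᵀ with hZ
  have hZT : Zᵀ = V * (D * Uᵀ) := by
    simp [hZ, Matrix.transpose_mul, hDT]
  have hZ2 : Z * Zᵀ = 1 := by
    rw [hZT, hZ, c1 _ _ _ _ hV1, c1 _ _ _ _ hDD, hU2]
  have hZ1 : Zᵀ * Z = 1 := mul_eq_one_comm.1 hZ2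
  have hZdet : Z.det = 1 := by
    rw [hZ, Matrix.det_mul, Matrix.det_mul, hdet, Matrix.det_transpose]
    linear_combination (V.det * V.det) * dU + dV
  have htr := frob_le hX.1 hZ1 (hmin Z ⟨hZ1, hZ2, hZdet⟩)
  rw [hSVD, trace_conv, trace_conv] at htr
  have hZD : Uᵀ * Z * V = D := by
    rw [hZ]
    calc Uᵀ * (U * D * Vᵀ) * V = (Uᵀ * U) * D * (Vᵀ * V) := by simp only [Matrix.mul_assoc]
      _ = D := by rw [hU1, hV1, Matrix.one_mul, Matrix.mul_one]
  rw [hZD] at htr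
  have hYD : Uᵀ * X * V = D := by
    apply huniq
    · rw [Matrix.transpose_mul, Matrix.transpose_mul, Matrix.transpose_transpose, c1 _ _ _ _ hV2,
        c1 _ _ _ _ hX.2.1, hU1]
    · rw [Matrix.det_mul, Matrix.det_mul, Matrix.det_transpose, hX.2.2, mul_one]
    · simpa [hD] using htr
  rw [hZ, ← hYD]
  calc X = (U * Uᵀ) * X * (V * Vᵀ) := by rw [hU2, hV2, Matrix.one_mul, Matrix.mul_one]
    _ = _ := by simp only [Matrix.mul_assoc]

/-- If the singular values of an invertible `A` are strictly decreasing and positive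
(expressed via an SVD `A = U Σ Vᵀ`), then the minimizer of the Frobenius distance to `A`
over `SO(n)` is unique. -/
theorem frechet_projection_onto_SO_unique (n : ℕ) (hn : 1 ≤ n)
    (A U V : Matrix (Fin n) (Fin n) ℝ) (σ : Fin n → ℝ)
    (hA : IsUnit A) (hU : IsOrth U) (hV : IsOrth V)
    (hσdec : StrictAnti σ) (hσpos : ∀ i, 0 < σ i)
    (hSVD : A = U * Matrix.diagonal σ * Vᵀ)
    (X₁ X₂ : Matrix (Fin n) (Fin n) ℝ) (hX₁ : IsSO X₁) (hX₂ : IsSO X₂)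
    (hmin₁ : ∀ X : Matrix (Fin n) (Fin n) ℝ, IsSO X → frobNorm (X₁ - A) ≤ frobNorm (X - A))
    (hmin₂ : ∀ X : Matrix (Fin n) (Fin n) ℝ, IsSO X → frobNorm (X₂ - A) ≤ frobNorm (X - A)) :
    X₁ = X₂ := by
  obtain ⟨m, rfl⟩ : ∃ m, n = m + 1 := ⟨n - 1, by omega⟩
  have dU : U.det * U.det = 1 := by
    have := congrArg Matrix.det hU.1
    rwa [Matrix.det_mul, Matrix.det_transpose, Matrix.det_one] at this
  have dV : V.det * V.det = 1 := by
    have := congrArg Matrix.det hV.1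
    rwa [Matrix.det_mul, Matrix.det_transpose, Matrix.det_one] at this
  have hd : (U.det * V.det) * (U.det * V.det) = 1 := by
    linear_combination (V.det * V.det) * dU + dV
  rcases mul_self_eq_one_iff.1 hd with h | h
  · have key := eq_of_diag hU hV hSVD (fun _ => 1) (fun _ => by norm_num) (by simp [h])
      (fun Y hY _ hle => key_pos hY σ hσpos (by simpa using hle))
    rw [key X₁ hX₁ hmin₁, key X₂ hX₂ hmin₂]
  · have key := eq_of_diag hU hV hSVD (lastNeg m)
      (fun i => by unfold lastNeg; split_ifs <;> norm_num)
      (by rw [h, Matrix.det_diagonal]; simp [lastNeg])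
      (fun Y hY hdet hle => key_neg hY (hdet.trans h) σ hσpos hσdec hle)
    rw [key X₁ hX₁ hmin₁, key X₂ hX₂ hmin₂]
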